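/- For all integers n ≥ 1 and 0 ≤ k ≤ n, the following polynomial identity in ℤ[p] holds: Σ_{a ∈ Γ^u_{n+1,k}} p^{vpk(a)} = Σ_{a ∈ Γ^u_{n,k}} p^{vpk(a)} + p · Σ_{a ∈ Γ^d_{n,k}} p^{vpk(a)}, where Γ^u_{n,k} (respectively Γ^d_{n,k}) is the set of sequences in Γ_{n,k} whose last entry is 1 (respectively −1). -/

import Mathlib

attribute [local instance] Classical.propDecidable

/-- The maximum drop size of a permutation (0-indexed positions and values). -/
def maxdrop {n : ℕ} (π : Equiv.Perm (Fin n)) : ℕ :=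
  Finset.univ.sup fun i : Fin n => (i : ℕ) - (π i : ℕ)

/-- `A(n,k)`: permutations of `[n]` with maximum drop size at most `k`. -/
def bddA (n k : ℕ) : Finset (Equiv.Perm (Fin n)) :=
  Finset.univ.filter fun π => maxdrop π ≤ k

/-- `S(n,k)`: permutations of `[n]` with `σ i - i ≤ k` for all `i`. -/
def bddS (n k : ℕ) : Finset (Equiv.Perm (Fin n)) :=
  Finset.univ.filter fun π => ∀ i : Fin n, (π i : ℕ) ≤ (i : ℕ) + k

/-- The number of inversions of a permutation. -/
def invStat {n : ℕ} (π : Equiv.Perm (Fin n)) : ℕ :=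
  (Finset.univ.filter fun p : Fin n × Fin n => p.1 < p.2 ∧ π p.2 < π p.1).card

/-- The number of left-to-right maxima of a permutation. -/
def lmaxStat {n : ℕ} (π : Equiv.Perm (Fin n)) : ℕ :=
  (Finset.univ.filter fun i : Fin n => ∀ j, j < i → π j < π i).card

/-- The number of cycles of a permutation, fixed points included. -/
def cycStat {n : ℕ} (π : Equiv.Perm (Fin n)) : ℕ :=
  π.cycleType.card + (Finset.univ.filter fun i => π i = i).card

/-- The sorting index: `σ` has a unique factorization
`σ = (i₁,j₁)(i₂,j₂)⋯(iₘ,jₘ)` into transpositions with `j₁ < j₂ < ⋯ < jₘ` and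
`iᵣ < jᵣ` for all `r`, and `sor σ = Σᵣ (jᵣ - iᵣ)`. -/
noncomputable def sorStat {n : ℕ} (σ : Equiv.Perm (Fin n)) : ℕ :=
  if h : ∃ l : List (Fin n × Fin n),
      (∀ p ∈ l, p.1 < p.2) ∧ l.Chain' (fun p q => p.2 < q.2) ∧
      σ = (l.map fun p => Equiv.swap p.1 p.2).prod
  then (h.choose.map fun p => (p.2 : ℕ) - (p.1 : ℕ)).sum
  else 0

/-- `DIS σ = sor σ⁻¹`. -/
noncomputable def DIS {n : ℕ} (σ : Equiv.Perm (Fin n)) : ℕ := sorStat σ⁻¹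

/-- 213-avoiding permutations: no `i < j < l` with `π j < π i < π l`. -/
def avoids213 {n : ℕ} (π : Equiv.Perm (Fin n)) : Prop :=
  ¬ ∃ i j l : Fin n, i < j ∧ j < l ∧ π j < π i ∧ π i < π l

/-- 132-avoiding permutations: no `i < j < l` with `π i < π l < π j`. -/
def avoids132 {n : ℕ} (π : Equiv.Perm (Fin n)) : Prop :=
  ¬ ∃ i j l : Fin n, i < j ∧ j < l ∧ π i < π l ∧ π l < π j

/-- 321-avoiding permutations: no `i < j < l` with `π i > π j > π l`. -/
def avoids321 {n : ℕ} (π : Equiv.Perm (Fin n)) : Prop :=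
  ¬ ∃ i j l : Fin n, i < j ∧ j < l ∧ π l < π j ∧ π j < π i

/-- The number of descents of a permutation. -/
def desStat {n : ℕ} (π : Equiv.Perm (Fin n)) : ℕ :=
  (Finset.univ.filter fun i : Fin n =>
    ∃ j : Fin n, (j : ℕ) = (i : ℕ) + 1 ∧ π j < π i).card

/-- The number of right-to-left maxima of a permutation. -/
def rmaxStat {n : ℕ} (π : Equiv.Perm (Fin n)) : ℕ :=
  (Finset.univ.filter fun i : Fin n => ∀ j, i < j → π j < π i).card

/-- The number of non-weak excedances before the last position. -/
def vnwStat {N : ℕ} (π : Equiv.Perm (Fin N)) : ℕ :=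
  (Finset.univ.filter fun i : Fin N => (i : ℕ) + 1 < N ∧ (π i : ℕ) < (i : ℕ)).card

/-- `Γ_{n,k}`: sequences of `n` ones (`true`) and `k` negative ones (`false`)
with all partial sums nonnegative. -/
noncomputable def GammaBP (n k : ℕ) : Finset (Fin (n + k) → Bool) :=
  Finset.univ.filter fun a =>
    (Finset.univ.filter fun i => a i = true).card = n ∧
    ∀ m ∈ Finset.range (n + k + 1),
      (Finset.univ.filter fun i : Fin (n + k) => (i : ℕ) < m ∧ a i = false).card ≤
      (Finset.univ.filter fun i : Fin (n + k) => (i : ℕ) < m ∧ a i = true).card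

/-- `vpk a`: the number of ones immediately followed by a `-1` that are not the
rightmost one. -/
def vpkStat {N : ℕ} (a : Fin N → Bool) : ℕ :=
  (Finset.univ.filter fun i : Fin N =>
    a i = true ∧ (∃ j : Fin N, (j : ℕ) = (i : ℕ) + 1 ∧ a j = false) ∧
    ∃ j : Fin N, i < j ∧ a j = true).card

/-- `Γ^u_{n,k}`: elements of `Γ_{n,k}` ending with a one. -/
noncomputable def GammaBPU (n k : ℕ) : Finset (Fin (n + k) → Bool) :=
  (GammaBP n k).filter fun a => ∀ i : Fin (n + k), (i : ℕ) + 1 = n + k → a i = true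

/-- `Γ^d_{n,k}`: elements of `Γ_{n,k}` ending with a negative one. -/
noncomputable def GammaBPD (n k : ℕ) : Finset (Fin (n + k) → Bool) :=
  (GammaBP n k).filter fun a => ∀ i : Fin (n + k), (i : ℕ) + 1 = n + k → a i = false

/-- The transposition `t_{i,j}` of `1`-based positions `i` and `j`. -/
def transp (n i j : ℕ) : Equiv.Perm (Fin n) :=
  if h : i - 1 < n ∧ j - 1 < n then Equiv.swap ⟨i - 1, h.1⟩ ⟨j - 1, h.2⟩ else 1

/-- `Ψ_{i,k} = 1 + sᵢ + sᵢsᵢ₋₁ + ⋯` (with `min i k + 1` terms) in `ℤ[Sₙ]`,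
where `sᵢ = (i, i+1)` (1-based). -/
noncomputable def PsiElt (n k i : ℕ) : MonoidAlgebra ℤ (Equiv.Perm (Fin n)) :=
  ∑ m ∈ Finset.range (min i k + 1),
    MonoidAlgebra.of ℤ (Equiv.Perm (Fin n))
      (((List.range m).map fun r => transp n (i - r) (i - r + 1)).prod)

/-- `Φ_{i,k} = 1 + t_{i,i+1} + t_{i-1,i+1} + ⋯` (with `min i k + 1` terms)
in `ℤ[Sₙ]`. -/
noncomputable def PhiElt (n k i : ℕ) : MonoidAlgebra ℤ (Equiv.Perm (Fin n)) :=
  ∑ m ∈ Finset.range (min i k + 1),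
    MonoidAlgebra.of ℤ (Equiv.Perm (Fin n)) (transp n (i + 1 - m) (i + 1))

/-- `[i]_q = 1 + q + ⋯ + q^{i-1}` as an element of `ℤ[q,t]`
(with `q = X 0`, `t = X 1`). -/
noncomputable def qBracket (i : ℕ) : MvPolynomial (Fin 2) ℤ :=
  ∑ j ∈ Finset.range i, MvPolynomial.X 0 ^ j

/-- Ballot sequences of length `N` with `n` ones. -/
def IsBal {N : ℕ} (n : ℕ) (a : Fin N → Bool) : Prop :=
  (∑ i, if a i = true then 1 else 0) = n ∧
    ∀ m < N + 1, (∑ i : Fin N, if (i : ℕ) < m ∧ a i = false then 1 else 0) ≤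
      ∑ i : Fin N, if (i : ℕ) < m ∧ a i = true then 1 else 0

theorem mem_GammaBP_iff {n k : ℕ} (a : Fin (n + k) → Bool) :
    a ∈ GammaBP n k ↔ IsBal n a := by
  simp only [GammaBP, IsBal, Finset.mem_filter, Finset.mem_univ, true_and, Finset.mem_range,
    Finset.card_filter]

theorem isBal_snoc {N n : ℕ} (b : Fin N → Bool) :
    IsBal (n + 1) (Fin.snoc b true : Fin (N + 1) → Bool) ↔ IsBal n b := by
  unfold IsBal
  simp only [Fin.sum_univ_castSucc, Fin.snoc_castSucc, Fin.snoc_last, Fin.val_castSucc,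
    Fin.val_last]
  constructor
  · rintro ⟨h1, h2⟩
    refine ⟨by simpa using h1, fun m hm => ?_⟩
    have := h2 m (by omega)
    have h3 : ¬ N < m := by omega
    simpa [h3] using this
  · rintro ⟨h1, h2⟩
    refine ⟨by simpa using h1, fun m hm => ?_⟩
    by_cases h3 : N < m
    · have := h2 N (by omega)
      have e : ∀ i : Fin N, (i : ℕ) < m := fun i => by omega
      have e' : ∀ i : Fin N, (i : ℕ) < N := fun i => i.2
      simp only [e, e', true_and] at this ⊢
      simp only [h3, true_and, if_true]
      simp only [Bool.true_eq_false, if_false]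
      omega
    · have := h2 m (by omega)
      simpa [h3] using this

theorem vpk_snoc {N : ℕ} (b : Fin N → Bool) :
    vpkStat (Fin.snoc b true : Fin (N + 1) → Bool) =
      (Finset.univ.filter fun i : Fin N =>
        b i = true ∧ (∃ j : Fin N, (j : ℕ) = (i : ℕ) + 1 ∧ b j = false)).card := by
  unfold vpkStat
  symm
  apply Finset.card_bij (fun i _ => i.castSucc)
  · intro i hi
    simp only [Finset.mem_filter, Finset.mem_univ, true_and] at hi ⊢
    obtain ⟨h1, j, h2, h3⟩ := hi
    refine ⟨by simpa using h1, ⟨j.castSucc, by simpa using h2, by simpa using h3⟩,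
      Fin.last N, Fin.castSucc_lt_last i, by simp⟩
  · intro i _ j _ h
    exact Fin.castSucc_injective _ h
  · intro i hi
    simp only [Finset.mem_filter, Finset.mem_univ, true_and] at hi
    obtain ⟨h1, ⟨j, h2, h3⟩, -⟩ := hi
    induction i using Fin.lastCases with
    | last => have := j.2; simp at h2; omega
    | cast i =>
      refine ⟨i, ?_, rfl⟩
      simp only [Finset.mem_filter, Finset.mem_univ, true_and]
      refine ⟨by simpa using h1, ?_⟩
      induction j using Fin.lastCases with
      | last => simp at h3
      | cast j => exact ⟨j, by simpa using h2, by simpa using h3⟩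

theorem vpk_snoc_up {N : ℕ} (b : Fin N → Bool) (hb : ∀ i : Fin N, (i : ℕ) + 1 = N → b i = true) :
    vpkStat (Fin.snoc b true : Fin (N + 1) → Bool) = vpkStat b := by
  rw [vpk_snoc]
  unfold vpkStat
  congr 1
  ext i
  simp only [Finset.mem_filter, Finset.mem_univ, true_and]
  constructor
  · rintro ⟨h1, j, h2, h3⟩
    refine ⟨h1, ⟨j, h2, h3⟩, ⟨N - 1, by omega⟩, ?_, hb _ ?_⟩
    · rw [Fin.lt_def]; simp only; omega
    · simp only; omega
  · rintro ⟨h1, h2, -⟩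
    exact ⟨h1, h2⟩

theorem vpk_snoc_down {N : ℕ} (b : Fin N → Bool)
    (hb : ∀ i : Fin N, (i : ℕ) + 1 = N → b i = false) (he : ∃ i, b i = true) :
    vpkStat (Fin.snoc b true : Fin (N + 1) → Bool) = vpkStat b + 1 := by
  rw [vpk_snoc]
  unfold vpkStat
  obtain ⟨r, hr, hmax⟩ : ∃ r, b r = true ∧ ∀ j, r < j → b j = false := by
    obtain ⟨i, hi⟩ := he
    obtain ⟨r, hr, hm⟩ := Finset.exists_max_image (Finset.univ.filter fun i => b i = true) id
      ⟨i, by simp [hi]⟩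
    refine ⟨r, by simpa using hr, fun j hj => ?_⟩
    by_contra hne
    have := hm j (by simpa using hne)
    exact absurd hj (not_lt.mpr this)
  have hrN : (r : ℕ) + 1 < N := by
    by_contra h
    have := hb r (by omega)
    simp [hr] at this
  rw [← Finset.card_insert_of_notMem (a := r)]
  · congr 1
    ext i
    simp only [Finset.mem_filter, Finset.mem_univ, true_and, Finset.mem_insert]
    constructor
    · rintro ⟨h1, h2⟩
      by_cases hir : i = r
      · exact Or.inl hir
      · refine Or.inr ⟨h1, h2, r, ?_, hr⟩
        by_contra hlt
        have := hmax i (lt_of_le_of_ne (not_lt.mp hlt) (Ne.symm hir))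
        simp [h1] at this
    · rintro (rfl | ⟨h1, h2, -⟩)
      · exact ⟨hr, ⟨i + 1, hrN⟩, rfl, hmax _ (by rw [Fin.lt_def]; simp)⟩
      · exact ⟨h1, h2⟩
  · simp only [Finset.mem_filter, Finset.mem_univ, true_and]
    rintro ⟨-, -, j, hj, h⟩
    simp [hmax j hj] at h

theorem sum_shift {N M n : ℕ} (hM : M = N + 1) (F : ∀ {L : ℕ}, (Fin L → Bool) → Polynomial ℤ)
    (S : Finset (Fin M → Bool)) (T : Finset (Fin N → Bool))
    (hS : ∀ a, a ∈ S ↔ IsBal (n + 1) a ∧ ∀ i : Fin M, (i : ℕ) + 1 = M → a i = true)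
    (hT : ∀ b, b ∈ T ↔ IsBal n b) :
    ∑ a ∈ S, F a = ∑ b ∈ T, F (Fin.snoc b true : Fin (N + 1) → Bool) := by
  subst hM
  symm
  apply Finset.sum_bij (fun b _ => (Fin.snoc b true : Fin (N + 1) → Bool))
  · intro b hb
    rw [hS, isBal_snoc]
    refine ⟨(hT b).1 hb, fun i hi => ?_⟩
    have : i = Fin.last N := Fin.ext (by simpa using hi)
    subst this
    simp
  · intro b _ c _ h
    have := congrArg (fun f => (Fin.init f : Fin N → Bool)) h
    simpa using this
  · intro a ha
    rw [hS] at ha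
    have hl := ha.2 (Fin.last N) (by simp)
    have e : (Fin.snoc (Fin.init a : Fin N → Bool) true : Fin (N + 1) → Bool) = a := by
      rw [← hl]; exact Fin.snoc_init_self a
    refine ⟨Fin.init a, ?_, e⟩
    rw [hT, ← isBal_snoc, e]
    exact ha.1
  · intros; rfl

/-- in `ℤ[p]`,
`Σ_{a ∈ Γ^u_{n+1,k}} p^{vpk a} = Σ_{a ∈ Γ^u_{n,k}} p^{vpk a} + p·Σ_{a ∈ Γ^d_{n,k}} p^{vpk a}`. -/
theorem stmt19 (n k : ℕ) (hn : 1 ≤ n) (hk : k ≤ n) :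
    ∑ a ∈ GammaBPU (n + 1) k, (Polynomial.X : Polynomial ℤ) ^ vpkStat a =
      ∑ a ∈ GammaBPU n k, (Polynomial.X : Polynomial ℤ) ^ vpkStat a +
        Polynomial.X * ∑ a ∈ GammaBPD n k, (Polynomial.X : Polynomial ℤ) ^ vpkStat a := by
  rw [sum_shift (N := n + k) (n := n) (by omega) (fun {L} a => (Polynomial.X : Polynomial ℤ) ^ vpkStat a)
    (GammaBPU (n + 1) k) (GammaBP n k) (fun a => by simp only [GammaBPU, Finset.mem_filter, mem_GammaBP_iff])
    mem_GammaBP_iff]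
  have hD : GammaBPD n k = (GammaBP n k).filter
      fun a => ¬ ∀ i : Fin (n + k), (i : ℕ) + 1 = n + k → a i = true := by
    unfold GammaBPD
    apply Finset.filter_congr
    intro a _
    constructor
    · intro h h'
      have h1 := h ⟨n + k - 1, by omega⟩ (by simp only; omega)
      rw [h' ⟨n + k - 1, by omega⟩ (by simp only; omega)] at h1
      cases h1
    · intro h i hi
      by_contra hne
      apply h
      intro j hj
      have : j = i := Fin.ext (by omega)
      subst this
      simpa using hne
  rw [← Finset.sum_filter_add_sum_filter_not (GammaBP n k)
    (fun a => ∀ i : Fin (n + k), (i : ℕ) + 1 = n + k → a i = true), ← hD, Finset.mul_sum]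
  congr 1
  · apply Finset.sum_congr
    · simp only [GammaBPU]
    · intro a ha
      rw [vpk_snoc_up a (Finset.mem_filter.1 ha).2]
  · apply Finset.sum_congr rfl
    intro a ha
    have ha := Finset.mem_filter.1 ha
    rw [vpk_snoc_down a ha.2, pow_succ']
    by_contra hne
    push Not at hne
    have := ((mem_GammaBP_iff a).1 ha.1).1
    simp [hne] at this
    omega
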